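/- arXiv:1608.08659 — 7 statements merged into one kernel-verified Lean document; each statement's English description precedes it below -/
import Mathlib

section
/- The determinant of the two-layer covariance matrix factorizes as det(Σ_Y) = det(A) · ∏_{k=0}^{K} det(Σ_k). -/
/-- the determinant of the two-layer covariance matrix `Σ_Y`
(whose `(l,m)` block is `δ_{lm} Σ_l + Σ_0`) factorizes as
`det(Σ_Y) = det(A) · ∏_{k=0}^{K} det(Σ_k)`, where `A = Σ_{k=0}^{K} Σ_k⁻¹`. -/
theorem det_two_layer_covariance
    (p K : ℕ) (hp : 1 ≤ p) (hK : 1 ≤ K)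
    (S0 : Matrix (Fin p) (Fin p) ℝ) (S : Fin K → Matrix (Fin p) (Fin p) ℝ)
    (hS0pd : S0.PosDef) (hS0sym : S0.IsSymm)
    (hSpd : ∀ k, (S k).PosDef) (hSsym : ∀ k, (S k).IsSymm) :
    (Matrix.of (fun (a b : Fin K × Fin p) =>
        (if a.1 = b.1 then S a.1 a.2 b.2 else 0) + S0 a.2 b.2)).det
      = (S0⁻¹ + ∑ k, (S k)⁻¹).det * (S0.det * ∏ k, (S k).det) := by
  classical
  have hu0 : IsUnit S0.det := hS0pd.det_pos.ne'.isUnit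
  have hu : ∀ k, IsUnit (S k).det := fun k => (hSpd k).det_pos.ne'.isUnit
  have hinv : (Matrix.blockDiagonal S)⁻¹ = Matrix.blockDiagonal (fun k => (S k)⁻¹) := by
    apply Matrix.inv_eq_right_inv
    rw [← Matrix.blockDiagonal_mul]
    have : (fun k => S k * (S k)⁻¹) = 1 := by
      funext k
      exact Matrix.mul_nonsing_inv _ (hu k)
    rw [this, Matrix.blockDiagonal_one]
  have huD : IsUnit (Matrix.blockDiagonal S).det := by
    rw [Matrix.det_blockDiagonal]
    exact (Finset.prod_ne_zero_iff.mpr fun k _ => (hu k).ne_zero).isUnit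
  let U : Matrix (Fin p × Fin K) (Fin p) ℝ :=
    Matrix.of fun a j => (1 : Matrix (Fin p) (Fin p) ℝ) a.1 j
  have hM : (Matrix.of (fun (a b : Fin K × Fin p) =>
        (if a.1 = b.1 then S a.1 a.2 b.2 else 0) + S0 a.2 b.2)).submatrix
        (Equiv.prodComm (Fin p) (Fin K)) (Equiv.prodComm (Fin p) (Fin K))
      = Matrix.blockDiagonal S + U * (S0 * U.transpose) := by
    ext ⟨i, k⟩ ⟨j, l⟩
    simp [U, Matrix.blockDiagonal_apply, Matrix.mul_apply, Matrix.one_apply]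
  have hT : U.transpose * Matrix.blockDiagonal (fun k => (S k)⁻¹) * U = ∑ k, (S k)⁻¹ := by
    ext i j
    simp [U, Matrix.blockDiagonal_apply, Matrix.mul_apply, Matrix.one_apply,
      Fintype.sum_prod_type, Matrix.sum_apply, Finset.sum_ite_irrel]
  rw [← Matrix.det_submatrix_equiv_self (Equiv.prodComm (Fin p) (Fin K)), hM,
    Matrix.det_add_mul _ _ huD, hinv, Matrix.det_blockDiagonal, Matrix.mul_assoc S0,
    Matrix.mul_assoc S0, hT, ← Matrix.mul_nonsing_inv S0 hu0, ← Matrix.mul_add, Matrix.det_mul]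
  ring
end

section
/- The inverse of the two-layer covariance matrix is given blockwise by Ω_Y = Σ_Y⁻¹, where Ω_Y is the Kp×Kp block matrix whose (l, m) block equals δ_{lm} Ω_l − Ω_l A⁻¹ Ω_m; equivalently, Σ_Y multiplied by this block matrix equals the Kp×Kp identity matrix. -/
/-- the inverse of the two-layer covariance matrix `Σ_Y`
(whose `(l,m)` block is `δ_{lm} Σ_l + Σ_0`) is the block matrix whose `(l,m)` block
is `δ_{lm} Ω_l − Ω_l A⁻¹ Ω_m`, with `Ω_k = Σ_k⁻¹` and `A = Σ_{k=0}^{K} Ω_k`;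
i.e. `Σ_Y` times this block matrix equals the identity. -/
theorem inverse_two_layer_covariance
    (p K : ℕ) (hp : 1 ≤ p) (hK : 1 ≤ K)
    (S0 : Matrix (Fin p) (Fin p) ℝ) (S : Fin K → Matrix (Fin p) (Fin p) ℝ)
    (hS0pd : S0.PosDef) (hS0sym : S0.IsSymm)
    (hSpd : ∀ k, (S k).PosDef) (hSsym : ∀ k, (S k).IsSymm) :
    (Matrix.of (fun (a b : Fin K × Fin p) =>
        (if a.1 = b.1 then S a.1 a.2 b.2 else 0) + S0 a.2 b.2)) *
      (Matrix.of (fun (a b : Fin K × Fin p) =>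
        (if a.1 = b.1 then (S a.1)⁻¹ a.2 b.2 else 0)
          - ((S a.1)⁻¹ * (S0⁻¹ + ∑ k, (S k)⁻¹)⁻¹ * (S b.1)⁻¹) a.2 b.2))
      = 1 := by
  have hA : (S0⁻¹ + ∑ k, (S k)⁻¹).PosDef :=
    hS0pd.inv.add_posSemidef (Matrix.posSemidef_sum _ fun k _ => (hSpd k).inv.posSemidef)
  have hAB := Matrix.mul_nonsing_inv _ ((Matrix.isUnit_iff_isUnit_det _).1 hA.isUnit)
  have h0 := Matrix.mul_nonsing_inv _ ((Matrix.isUnit_iff_isUnit_det _).1 hS0pd.isUnit)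
  have hk := fun k => Matrix.mul_nonsing_inv _ ((Matrix.isUnit_iff_isUnit_det _).1 (hSpd k).isUnit)
  generalize (S0⁻¹ + ∑ k, (S k)⁻¹)⁻¹ = B at hAB ⊢
  have hSB : S0 * (∑ k, (S k)⁻¹) * B = S0 - B := by
    have h1 : S0 * ((S0⁻¹ + ∑ k, (S k)⁻¹) * B) = S0 := by rw [hAB, mul_one]
    rw [← mul_assoc, mul_add, h0, add_mul, one_mul] at h1
    exact eq_sub_of_add_eq' h1
  have key : ∀ l m : Fin K, ∑ k, ((if l = k then S l else 0) + S0) *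
      ((if k = m then (S k)⁻¹ else 0) - (S k)⁻¹ * B * (S m)⁻¹) = if l = m then 1 else 0 := by
    intro l m
    have e : ∑ k, S0 * ((S k)⁻¹ * B * (S m)⁻¹) = S0 * (∑ k, (S k)⁻¹) * B * (S m)⁻¹ := by
      simp only [Finset.mul_sum, Finset.sum_mul, mul_assoc]
    have e2 : S l * ((S l)⁻¹ * B * (S m)⁻¹) = B * (S m)⁻¹ := by
      rw [← mul_assoc, ← mul_assoc, hk, one_mul]
    simp only [add_mul, mul_sub, Finset.sum_add_distrib, Finset.sum_sub_distrib, e, hSB, ite_mul,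
      zero_mul, mul_ite, mul_zero, Finset.sum_ite_eq, Finset.sum_ite_eq', Finset.mem_univ, if_true,
      e2, sub_mul]
    have e3 : (if l = m then S l * (S m)⁻¹ else 0) = if l = m then 1 else 0 := by
      split_ifs with hlm
      · rw [hlm, hk]
      · rfl
    rw [← e3]
    abel
  ext ⟨l, i⟩ ⟨m, j⟩
  have h := congrFun (congrFun (key l m) i) j
  rw [Matrix.sum_apply] at h
  rw [Matrix.mul_apply, Fintype.sum_prod_type]
  refine Eq.trans ?_ (h.trans ?_)
  · refine Finset.sum_congr rfl fun k _ => ?_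
    rw [Matrix.mul_apply]
    refine Finset.sum_congr rfl fun x _ => ?_
    simp only [Matrix.of_apply, Matrix.add_apply, Matrix.sub_apply]
    split_ifs <;> simp
  · simp only [Matrix.one_apply, Prod.mk.injEq]
    by_cases hlm : l = m <;> simp [hlm, Matrix.one_apply]
end

section
/- In the extended model with systemic intensity parameters, the determinant of the covariance matrix factorizes as det(Σ_Y^α) = det(A_ext) · ∏_{k=0}^{K} det(Σ_k). -/
/-- in the extended model with systemic intensity parameters `α_k`,
the determinant of the covariance matrix `Σ_Y^α` (whose `(l,m)` block is
`δ_{lm} Σ_l + α_l α_m Σ_0`) factorizes as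
`det(Σ_Y^α) = det(A_ext) · ∏_{k=0}^{K} det(Σ_k)`, where
`A_ext = Σ_0⁻¹ + Σ_{k=1}^{K} α_k² Σ_k⁻¹`. -/
theorem det_extended_two_layer_covariance
    (p K : ℕ) (hp : 1 ≤ p) (hK : 1 ≤ K) (α : Fin K → ℝ)
    (S0 : Matrix (Fin p) (Fin p) ℝ) (S : Fin K → Matrix (Fin p) (Fin p) ℝ)
    (hS0pd : S0.PosDef) (hS0sym : S0.IsSymm)
    (hSpd : ∀ k, (S k).PosDef) (hSsym : ∀ k, (S k).IsSymm) :
    (Matrix.of (fun (a b : Fin K × Fin p) =>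
        (if a.1 = b.1 then S a.1 a.2 b.2 else 0) + α a.1 * α b.1 * S0 a.2 b.2)).det
      = (S0⁻¹ + ∑ k, (α k) ^ 2 • (S k)⁻¹).det * (S0.det * ∏ k, (S k).det) := by
  have hu0 : IsUnit S0.det := hS0pd.det_pos.ne'.isUnit
  have hu : ∀ k, IsUnit (S k).det := fun k => (hSpd k).det_pos.ne'.isUnit
  let D : Matrix (Fin K × Fin p) (Fin K × Fin p) ℝ :=
    (Matrix.blockDiagonal S).submatrix (Equiv.prodComm _ _) (Equiv.prodComm _ _)
  let D' : Matrix (Fin K × Fin p) (Fin K × Fin p) ℝ :=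
    (Matrix.blockDiagonal fun k => (S k)⁻¹).submatrix (Equiv.prodComm _ _) (Equiv.prodComm _ _)
  let U : Matrix (Fin K × Fin p) (Fin p) ℝ :=
    Matrix.of fun a j => α a.1 * (1 : Matrix (Fin p) (Fin p) ℝ) a.2 j
  let V : Matrix (Fin p) (Fin K × Fin p) ℝ := Matrix.of fun i b => α b.1 * S0 i b.2
  have hDdet : D.det = ∏ k, (S k).det := by
    rw [Matrix.det_submatrix_equiv_self, Matrix.det_blockDiagonal]
  have hDu : IsUnit D.det := by
    rw [hDdet]
    exact (Finset.prod_ne_zero_iff.mpr fun k _ => (hu k).ne_zero).isUnit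
  have hDinv : D⁻¹ = D' := by
    apply Matrix.inv_eq_right_inv
    simp only [D, D']
    rw [Matrix.submatrix_mul_equiv, ← Matrix.blockDiagonal_mul]
    have : (fun k => S k * (S k)⁻¹) = 1 := by
      funext k
      exact Matrix.mul_nonsing_inv _ (hu k)
    rw [this, Matrix.blockDiagonal_one, Matrix.submatrix_one_equiv]
  have hM : (Matrix.of (fun (a b : Fin K × Fin p) =>
        (if a.1 = b.1 then S a.1 a.2 b.2 else 0) + α a.1 * α b.1 * S0 a.2 b.2)) = D + U * V := by
    ext ⟨k, i⟩ ⟨l, j⟩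
    simp [D, U, V, Matrix.mul_apply, Matrix.blockDiagonal_apply, Matrix.one_apply, mul_assoc]
  have hVU : V * D' * U = S0 * ∑ k, (α k) ^ 2 • (S k)⁻¹ := by
    ext i j
    simp only [D', U, V, Matrix.mul_apply, Matrix.blockDiagonal_apply, Matrix.one_apply,
      Fintype.sum_prod_type, Matrix.sum_apply, Matrix.smul_apply, Matrix.submatrix_apply,
      Matrix.of_apply, Equiv.prodComm_apply, Prod.swap, smul_eq_mul, Finset.mul_sum,
      mul_ite, mul_one, mul_zero, Finset.sum_ite_eq', Finset.sum_ite_eq, Finset.mem_univ, if_true]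
    refine Eq.trans ?_ Finset.sum_comm
    refine Finset.sum_congr rfl fun k _ => ?_
    rw [Finset.sum_comm, Finset.sum_mul]
    refine Finset.sum_congr rfl fun x _ => ?_
    simp only [Finset.sum_ite_eq', Finset.mem_univ, if_true]
    ring
  rw [hM, Matrix.det_add_mul _ _ hDu, hDinv, hVU, hDdet]
  have : 1 + S0 * ∑ k, (α k) ^ 2 • (S k)⁻¹ = S0 * (S0⁻¹ + ∑ k, (α k) ^ 2 • (S k)⁻¹) := by
    rw [Matrix.mul_add, Matrix.mul_nonsing_inv _ hu0]
  rw [this, Matrix.det_mul]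
  ring
end

section
/- In the extended model with systemic intensity parameters, the inverse of the covariance matrix is given blockwise by the Kp×Kp matrix whose (l, m) block equals δ_{lm} Ω_l − α_l α_m Ω_l A_ext⁻¹ Ω_m; equivalently, Σ_Y^α multiplied by this block matrix equals the Kp×Kp identity matrix. -/
/-- in the extended model with systemic intensity parameters `α_k`,
the inverse of `Σ_Y^α` (whose `(l,m)` block is `δ_{lm} Σ_l + α_l α_m Σ_0`) is the
block matrix whose `(l,m)` block is `δ_{lm} Ω_l − α_l α_m Ω_l A_ext⁻¹ Ω_m`, with
`Ω_k = Σ_k⁻¹` and `A_ext = Ω_0 + Σ_{k=1}^{K} α_k² Ω_k`; i.e. `Σ_Y^α` times this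
block matrix equals the identity. -/
theorem inverse_extended_two_layer_covariance
    (p K : ℕ) (hp : 1 ≤ p) (hK : 1 ≤ K) (α : Fin K → ℝ)
    (S0 : Matrix (Fin p) (Fin p) ℝ) (S : Fin K → Matrix (Fin p) (Fin p) ℝ)
    (hS0pd : S0.PosDef) (hS0sym : S0.IsSymm)
    (hSpd : ∀ k, (S k).PosDef) (hSsym : ∀ k, (S k).IsSymm) :
    (Matrix.of (fun (a b : Fin K × Fin p) =>
        (if a.1 = b.1 then S a.1 a.2 b.2 else 0) + α a.1 * α b.1 * S0 a.2 b.2)) *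
      (Matrix.of (fun (a b : Fin K × Fin p) =>
        (if a.1 = b.1 then (S a.1)⁻¹ a.2 b.2 else 0)
          - α a.1 * α b.1 *
            ((S a.1)⁻¹ * (S0⁻¹ + ∑ k, (α k) ^ 2 • (S k)⁻¹)⁻¹ * (S b.1)⁻¹) a.2 b.2))
      = 1 := by
  classical
  have hA : (S0⁻¹ + ∑ k, (α k) ^ 2 • (S k)⁻¹).PosDef := by
    refine hS0pd.inv.add_posSemidef ?_
    refine Matrix.posSemidef_sum _ fun k _ => ?_
    exact (hSpd k).inv.posSemidef.smul (sq_nonneg _)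
  set W := ∑ k, (α k) ^ 2 • (S k)⁻¹ with hW
  have hB : (S0⁻¹ + W) * (S0⁻¹ + W)⁻¹ = 1 :=
    Matrix.mul_nonsing_inv _ ((Matrix.isUnit_iff_isUnit_det _).1 hA.isUnit)
  generalize (S0⁻¹ + W)⁻¹ = B at hB ⊢
  have h0 : S0 * S0⁻¹ = 1 :=
    Matrix.mul_nonsing_inv _ ((Matrix.isUnit_iff_isUnit_det _).1 hS0pd.isUnit)
  have hk : ∀ k, S k * (S k)⁻¹ = 1 := fun k =>
    Matrix.mul_nonsing_inv _ ((Matrix.isUnit_iff_isUnit_det _).1 (hSpd k).isUnit)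
  have hkey : S0 = B + S0 * W * B := by
    have h := congrArg (fun X => S0 * X) hB
    simp only [add_mul, mul_add, ← mul_assoc, h0, one_mul, mul_one] at h
    exact h.symm
  have hblock : ∀ l m : Fin K,
      ∑ k, ((if l = k then S l else 0) + (α l * α k) • S0) *
        ((if k = m then (S k)⁻¹ else 0) - (α k * α m) • ((S k)⁻¹ * B * (S m)⁻¹))
      = if l = m then 1 else 0 := by
    intro l m
    have e : S0 * W * B * (S m)⁻¹
        = ∑ k, (α k ^ 2) • (S0 * ((S k)⁻¹ * B * (S m)⁻¹)) := by
      simp only [hW, Finset.mul_sum, Finset.sum_mul, Matrix.mul_smul, Matrix.smul_mul, mul_assoc]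
    have e2 : ∀ k, (α l * α k) • S0 * ((α k * α m) • ((S k)⁻¹ * B * (S m)⁻¹))
        = (α l * α m) • ((α k ^ 2) • (S0 * ((S k)⁻¹ * B * (S m)⁻¹))) := by
      intro k
      rw [Matrix.smul_mul, Matrix.mul_smul, smul_smul, smul_smul]
      congr 1
      ring
    have e3 : S l * ((S l)⁻¹ * B * (S m)⁻¹) = B * (S m)⁻¹ := by
      rw [← mul_assoc, ← mul_assoc, hk, one_mul]
    have e4 : S0 * (S m)⁻¹ = B * (S m)⁻¹ + S0 * W * B * (S m)⁻¹ := by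
      rw [← add_mul, ← hkey]
    simp only [add_mul, mul_sub, Finset.sum_add_distrib, Finset.sum_sub_distrib, e2,
      ← Finset.smul_sum, ← e, ite_mul, mul_ite, zero_mul, mul_zero, Finset.sum_ite_eq,
      Finset.sum_ite_eq', Finset.mem_univ, if_true]
    rw [Matrix.mul_smul, Matrix.smul_mul, e3, e4, smul_add, add_sub_cancel_right]
    by_cases hlm : l = m
    · subst hlm
      simp [hk]
    · simp [hlm]
  ext ⟨l, i⟩ ⟨m, j⟩
  have h := congrFun (congrFun (hblock l m) i) j
  rw [Matrix.mul_apply, Fintype.sum_prod_type]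
  rw [Matrix.sum_apply] at h
  refine Eq.trans (Finset.sum_congr rfl fun k _ => ?_) (h.trans ?_)
  · rw [Matrix.mul_apply]
    refine Finset.sum_congr rfl fun x _ => ?_
    simp only [Matrix.of_apply, Matrix.add_apply, Matrix.sub_apply, Matrix.smul_apply, smul_eq_mul]
    split_ifs <;> simp
  · by_cases hlm : l = m <;> simp [hlm, Matrix.one_apply]
end

section
/- (Proposition 1, part ii) Each iteration of the graphical EM algorithm does not decrease the penalized log-likelihood: if Ω^{(t)} = (Ω_0^{(t)}, …, Ω_K^{(t)}) is a tuple of real symmetric positive definite p×p matrices, and Ω^{(t+1)} is a tuple of real symmetric positive definite p×p matrices maximizing Q(Ω) − Pen(Ω) over all such tuples, where Q(Ω) = Σ_{k=0}^{K} [log det(Ω_k) − tr(Ω_k Σ̇_k)] with Σ̇_0 = A(Ω^{(t)})⁻¹ + A(Ω^{(t)})⁻¹ (Σ_{l,m=1}^{K} Ω_l^{(t)} Σ̂_{(l,m)} Ω_m^{(t)}) A(Ω^{(t)})⁻¹ and, for 1 ≤ k ≤ K, Σ̇_k = Σ̂_{(k,k)} − Σ_{l=1}^{K} Σ̂_{(k,l)}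 Ω_l^{(t)} A(Ω^{(t)})⁻¹ − A(Ω^{(t)})⁻¹ Σ_{l=1}^{K} Ω_l^{(t)} Σ̂_{(l,k)} + A(Ω^{(t)})⁻¹ (Σ_{l,m=1}^{K} Ω_l^{(t)} Σ̂_{(l,m)} Ω_m^{(t)}) A(Ω^{(t)})⁻¹ + A(Ω^{(t)})⁻¹, then ℓ(Ω^{(t+1)}) − Pen(Ω^{(t+1)}) ≥ ℓ(Ω^{(t)}) − Pen(Ω^{(t)}). -/
open Matrix

/-- The `(l,m)` block (of size `p × p`) of a `Kp × Kp` matrix. -/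
def blockOf {p K : ℕ} (S : Matrix (Fin K × Fin p) (Fin K × Fin p) ℝ)
    (l m : Fin K) : Matrix (Fin p) (Fin p) ℝ :=
  Matrix.of fun i j => S (l, i) (m, j)

/-- The ℓ1 norm of the off-diagonal entries of a square matrix. -/
def offDiagL1 {p : ℕ} (W : Matrix (Fin p) (Fin p) ℝ) : ℝ :=
  ∑ i, ∑ j, if i = j then 0 else |W i j|

/-- The penalty `Pen(Ω) = λ_1 Σ_{k=1}^K |Ω_k⁻|_1 + λ_2 |Ω_0⁻|_1`. -/
def pen {p K : ℕ} (lam1 lam2 : ℝ)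
    (Om0 : Matrix (Fin p) (Fin p) ℝ) (Om : Fin K → Matrix (Fin p) (Fin p) ℝ) : ℝ :=
  lam1 * (∑ k, offDiagL1 (Om k)) + lam2 * offDiagL1 Om0

/-- The log-likelihood `ℓ(Ω)` of the two-layer model. -/
noncomputable def loglik {p K : ℕ}
    (S : Matrix (Fin K × Fin p) (Fin K × Fin p) ℝ)
    (Om0 : Matrix (Fin p) (Fin p) ℝ) (Om : Fin K → Matrix (Fin p) (Fin p) ℝ) : ℝ :=
  (∑ k, (Real.log (Om k).det - (blockOf S k k * Om k).trace))
    + Real.log Om0.det - Real.log (Om0 + ∑ k, Om k).det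
    + ∑ l, ∑ m, (Om l * blockOf S l m * Om m * (Om0 + ∑ k, Om k)⁻¹).trace

/-- The E-step matrix `Σ̇_0` computed from the current iterate `Ω^{(t)}`. -/
noncomputable def SdotZero {p K : ℕ}
    (S : Matrix (Fin K × Fin p) (Fin K × Fin p) ℝ)
    (Om0t : Matrix (Fin p) (Fin p) ℝ) (Omt : Fin K → Matrix (Fin p) (Fin p) ℝ) :
    Matrix (Fin p) (Fin p) ℝ :=
  (Om0t + ∑ k, Omt k)⁻¹
    + (Om0t + ∑ k, Omt k)⁻¹ * (∑ l, ∑ m, Omt l * blockOf S l m * Omt m)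
      * (Om0t + ∑ k, Omt k)⁻¹

/-- The E-step matrix `Σ̇_k` (for `1 ≤ k ≤ K`) computed from the current iterate. -/
noncomputable def SdotK {p K : ℕ}
    (S : Matrix (Fin K × Fin p) (Fin K × Fin p) ℝ)
    (Om0t : Matrix (Fin p) (Fin p) ℝ) (Omt : Fin K → Matrix (Fin p) (Fin p) ℝ)
    (k : Fin K) : Matrix (Fin p) (Fin p) ℝ :=
  blockOf S k k
    - (∑ l, blockOf S k l * Omt l) * (Om0t + ∑ j, Omt j)⁻¹
    - (Om0t + ∑ j, Omt j)⁻¹ * (∑ l, Omt l * blockOf S l k)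
    + (Om0t + ∑ j, Omt j)⁻¹ * (∑ l, ∑ m, Omt l * blockOf S l m * Omt m)
      * (Om0t + ∑ j, Omt j)⁻¹
    + (Om0t + ∑ j, Omt j)⁻¹

/-- The EM surrogate `Q(Ω; Ω^{(t)}) = Σ_{k=0}^K [log det Ω_k − tr(Ω_k Σ̇_k)]`. -/
noncomputable def Qsurrogate {p K : ℕ}
    (S : Matrix (Fin K × Fin p) (Fin K × Fin p) ℝ)
    (Om0t : Matrix (Fin p) (Fin p) ℝ) (Omt : Fin K → Matrix (Fin p) (Fin p) ℝ)
    (Om0 : Matrix (Fin p) (Fin p) ℝ) (Om : Fin K → Matrix (Fin p) (Fin p) ℝ) : ℝ :=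
  (Real.log Om0.det - (Om0 * SdotZero S Om0t Omt).trace)
    + ∑ k, (Real.log (Om k).det - (Om k * SdotK S Om0t Omt k).trace)

open scoped MatrixOrder in
lemma exists_factor_aux {p : ℕ} {A : Matrix (Fin p) (Fin p) ℝ} (hA : A.PosSemidef) :
    ∃ X : Matrix (Fin p) (Fin p) ℝ, A = Xᴴ * X :=
  CStarAlgebra.nonneg_iff_eq_star_mul_self.mp hA.nonneg

lemma trace_mul_nonneg_aux {p : ℕ} {P B : Matrix (Fin p) (Fin p) ℝ}
    (hP : P.PosSemidef) (hB : B.PosDef) : 0 ≤ (P * B⁻¹).trace := by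
  obtain ⟨X, hX⟩ := exists_factor_aux hB.inv.posSemidef
  rw [hX, ← Matrix.mul_assoc, Matrix.trace_mul_comm, ← Matrix.mul_assoc]
  exact (hP.mul_mul_conjTranspose_same X).trace_nonneg

lemma log_det_le_aux {p : ℕ} {C : Matrix (Fin p) (Fin p) ℝ}
    (hC : C.PosDef) : Real.log C.det ≤ C.trace - p := by
  have h1 : C.det = ∏ i, hC.isHermitian.eigenvalues i := by
    simpa using hC.isHermitian.det_eq_prod_eigenvalues
  have h2 : C.trace = ∑ i, hC.isHermitian.eigenvalues i := by
    simpa using hC.isHermitian.trace_eq_sum_eigenvalues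
  rw [h1, h2, Real.log_prod (fun i _ => (hC.eigenvalues_pos i).ne')]
  calc _ ≤ ∑ i, (hC.isHermitian.eigenvalues i - 1) :=
        Finset.sum_le_sum fun i _ => Real.log_le_sub_one_of_pos (hC.eigenvalues_pos i)
    _ = _ := by simp

lemma log_det_sub_le_aux {p : ℕ} {A B : Matrix (Fin p) (Fin p) ℝ}
    (hA : A.PosDef) (hB : B.PosDef) :
    Real.log B.det - Real.log A.det ≤ (B * A⁻¹).trace - p := by
  obtain ⟨X, hX⟩ := exists_factor_aux hA.inv.posSemidef
  have hdet : X.det * X.det = (A.det)⁻¹ := by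
    have := congrArg Matrix.det hX
    rw [Matrix.det_mul, Matrix.det_conjTranspose, Matrix.det_nonsing_inv,
      Ring.inverse_eq_inv'] at this
    simpa using this.symm
  have hXd : X.det ≠ 0 := by
    intro h
    rw [h] at hdet
    have := inv_pos.2 hA.det_pos
    simp at hdet
    exact hA.det_pos.ne' hdet.symm
  have hC : (X * B * Xᴴ).PosDef := by
    have hu : IsUnit X := (Matrix.isUnit_iff_isUnit_det X).2 (isUnit_iff_ne_zero.2 hXd)
    refine hB.mul_mul_conjTranspose_same ?_
    exact Matrix.vecMul_injective_of_isUnit hu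
  have h := log_det_le_aux hC
  have e1 : (X * B * Xᴴ).det = (A.det)⁻¹ * B.det := by
    rw [Matrix.det_mul, Matrix.det_mul, Matrix.det_conjTranspose, ← hdet]
    simp; ring
  have e2 : (X * B * Xᴴ).trace = (B * A⁻¹).trace := by
    rw [hX, Matrix.mul_assoc, Matrix.trace_mul_comm, Matrix.mul_assoc]
  rw [e1, e2, Real.log_mul (inv_ne_zero hA.det_pos.ne') hB.det_pos.ne', Real.log_inv] at h
  linarith

lemma gap_aux {p K : ℕ} (S : Matrix (Fin K × Fin p) (Fin K × Fin p) ℝ)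
    (Om0t Om0 : Matrix (Fin p) (Fin p) ℝ) (Omt Om : Fin K → Matrix (Fin p) (Fin p) ℝ)
    (hB : IsUnit (Om0 + ∑ k, Om k).det) :
    loglik S Om0 Om - Qsurrogate S Om0t Omt Om0 Om =
      - Real.log (Om0 + ∑ k, Om k).det
      + ((Om0 + ∑ k, Om k) * (Om0t + ∑ k, Omt k)⁻¹).trace
      + ∑ l, ∑ m, ((Om l - (Om0 + ∑ k, Om k) * (Om0t + ∑ k, Omt k)⁻¹ * Omt l) * blockOf S l m
          * (Om m - Omt m * (Om0t + ∑ k, Omt k)⁻¹ * (Om0 + ∑ k, Om k))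
          * (Om0 + ∑ k, Om k)⁻¹).trace := by
  unfold loglik Qsurrogate SdotZero SdotK
  generalize (Om0t + ∑ k, Omt k)⁻¹ = R
  obtain ⟨B, hBdef⟩ : ∃ B, B = Om0 + ∑ k, Om k := ⟨_, rfl⟩
  have h0 : Om0 = B - ∑ k, Om k := by rw [hBdef]; abel
  rw [← hBdef] at hB ⊢
  have key : ∀ l m, ((Om l - B * R * Omt l) * blockOf S l m
          * (Om m - Omt m * R * B) * B⁻¹).trace =
      (Om l * blockOf S l m * Om m * B⁻¹).trace
      - (Om m * R * (Omt l * blockOf S l m)).trace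
      - (Om l * (blockOf S l m * Omt m * R)).trace
      + (B * (R * (Omt l * blockOf S l m * Omt m) * R)).trace := by
    intro l m
    have e : (Om l - B * R * Omt l) * blockOf S l m * (Om m - Omt m * R * B) * B⁻¹
       = Om l * blockOf S l m * Om m * B⁻¹ - B * (R * (Omt l * blockOf S l m) * Om m * B⁻¹)
        - Om l * (blockOf S l m * Omt m * R) * (B * B⁻¹)
        + B * (R * (Omt l * blockOf S l m * Omt m) * R) * (B * B⁻¹) := by
      noncomm_ring
    rw [e, Matrix.mul_nonsing_inv B hB, Matrix.mul_one, Matrix.mul_one, Matrix.trace_add,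
      Matrix.trace_sub, Matrix.trace_sub]
    congr 3
    rw [Matrix.trace_mul_comm, Matrix.mul_assoc, Matrix.nonsing_inv_mul B hB, Matrix.mul_one,
      Matrix.trace_mul_comm, Matrix.mul_assoc]
  simp only [key]
  obtain ⟨M, hM⟩ : ∃ M, M = ∑ l, ∑ m, Omt l * blockOf S l m * Omt m := ⟨_, rfl⟩
  have k1 : ∑ l, ∑ m, (B * (R * (Omt l * blockOf S l m * Omt m) * R)).trace
      = (B * (R * M * R)).trace := by
    rw [hM]; simp only [Matrix.mul_sum, Matrix.sum_mul, Matrix.trace_sum]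
  have k2 : ∑ l, ∑ m, (Om l * (blockOf S l m * Omt m * R)).trace
      = ∑ k, (Om k * ((∑ l, blockOf S k l * Omt l) * R)).trace := by
    simp only [Matrix.mul_sum, Matrix.sum_mul, Matrix.trace_sum]
  have k3 : ∑ l, ∑ m, (Om m * R * (Omt l * blockOf S l m)).trace
      = ∑ k, (Om k * (R * (∑ l, Omt l * blockOf S l k))).trace := by
    rw [Finset.sum_comm]
    simp only [Matrix.mul_sum, Matrix.trace_sum, Matrix.mul_assoc]
  have k4 : ∀ X, (Om0 * X).trace = (B * X).trace - ∑ k, (Om k * X).trace := by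
    intro X
    rw [h0, Matrix.sub_mul, Matrix.trace_sub, Matrix.sum_mul, Matrix.trace_sum]
  simp only [Finset.sum_add_distrib, Finset.sum_sub_distrib, k1, k2, k3, ← hM]
  rw [k4]
  simp only [Matrix.mul_add, Matrix.mul_sub, Matrix.trace_add, Matrix.trace_sub,
    Finset.sum_add_distrib, Finset.sum_sub_distrib]
  have k5 : ∑ k, (blockOf S k k * Om k).trace = ∑ k, (Om k * blockOf S k k).trace :=
    Finset.sum_congr rfl fun k _ => Matrix.trace_mul_comm _ _
  rw [k5]
  ring

lemma quad_nonneg_aux {p K : ℕ} (S : Matrix (Fin K × Fin p) (Fin K × Fin p) ℝ)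
    (hS : S.PosSemidef) (G : Fin K → Matrix (Fin p) (Fin p) ℝ)
    {B : Matrix (Fin p) (Fin p) ℝ} (hB : B.PosDef) :
    0 ≤ ∑ l, ∑ m, (G l * blockOf S l m * (G m)ᵀ * B⁻¹).trace := by
  let L : Matrix (Fin p) (Fin K × Fin p) ℝ := Matrix.of fun i x => G x.1 i x.2
  have h : ∑ l, ∑ m, G l * blockOf S l m * (G m)ᵀ = L * S * Lᴴ := by
    ext i j
    simp only [Matrix.sum_apply, Matrix.mul_apply, Fintype.sum_prod_type, L, blockOf,
      Matrix.of_apply, Matrix.conjTranspose_apply, Matrix.transpose_apply, star_trivial,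
      Finset.sum_mul]
    rw [Finset.sum_comm]
    refine Finset.sum_congr rfl fun m _ => ?_
    rw [Finset.sum_comm]
  have h2 := trace_mul_nonneg_aux (hS.mul_mul_conjTranspose_same L) hB
  rw [← h] at h2
  simpa only [Matrix.sum_mul, Matrix.trace_sum] using h2

/-- Proposition 1, part ii: each iteration of the graphical EM algorithm does
not decrease the penalized log-likelihood.  Here `S = (1/n) Σ_i y_i y_iᵀ` is the sample
covariance matrix, `Ω^{(t)}` is the current iterate, and `Ω^{(t+1)}` maximizes
`Q(·; Ω^{(t)}) − Pen(·)` over tuples of real symmetric positive definite matrices. -/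
theorem em_iteration_nondecreasing
    (p K n : ℕ) (hp : 1 ≤ p) (hK : 1 ≤ K) (hn : 1 ≤ n)
    (lam1 lam2 : ℝ) (hlam1 : 0 ≤ lam1) (hlam2 : 0 ≤ lam2)
    (y : Fin n → (Fin K × Fin p) → ℝ)
    (S : Matrix (Fin K × Fin p) (Fin K × Fin p) ℝ)
    (hS : S = (n : ℝ)⁻¹ • ∑ i, Matrix.vecMulVec (y i) (y i))
    (Om0t Om0t1 : Matrix (Fin p) (Fin p) ℝ)
    (Omt Omt1 : Fin K → Matrix (Fin p) (Fin p) ℝ)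
    (h0tsym : Om0t.IsSymm) (h0tpd : Om0t.PosDef)
    (htsym : ∀ k, (Omt k).IsSymm) (htpd : ∀ k, (Omt k).PosDef)
    (h0t1sym : Om0t1.IsSymm) (h0t1pd : Om0t1.PosDef)
    (ht1sym : ∀ k, (Omt1 k).IsSymm) (ht1pd : ∀ k, (Omt1 k).PosDef)
    (hmax : ∀ (Om0 : Matrix (Fin p) (Fin p) ℝ) (Om : Fin K → Matrix (Fin p) (Fin p) ℝ),
      Om0.IsSymm → Om0.PosDef → (∀ k, (Om k).IsSymm) → (∀ k, (Om k).PosDef) →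
      Qsurrogate S Om0t Omt Om0 Om - pen lam1 lam2 Om0 Om
        ≤ Qsurrogate S Om0t Omt Om0t1 Omt1 - pen lam1 lam2 Om0t1 Omt1) :
    loglik S Om0t Omt - pen lam1 lam2 Om0t Omt
      ≤ loglik S Om0t1 Omt1 - pen lam1 lam2 Om0t1 Omt1 := by
  have hSp : S.PosSemidef := by
    rw [hS]
    refine Matrix.PosSemidef.smul ?_ (by positivity)
    refine Matrix.posSemidef_sum _ fun i _ => ?_
    simpa using Matrix.posSemidef_vecMulVec_self_star (y i)
  have hA : (Om0t + ∑ k, Omt k).PosDef :=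
    h0tpd.add_posSemidef (Matrix.posSemidef_sum _ fun k _ => (htpd k).posSemidef)
  have hB : (Om0t1 + ∑ k, Omt1 k).PosDef :=
    h0t1pd.add_posSemidef (Matrix.posSemidef_sum _ fun k _ => (ht1pd k).posSemidef)
  have hAu : IsUnit (Om0t + ∑ k, Omt k).det := isUnit_iff_ne_zero.2 hA.det_pos.ne'
  have hBu : IsUnit (Om0t1 + ∑ k, Omt1 k).det := isUnit_iff_ne_zero.2 hB.det_pos.ne'
  have g1 := gap_aux S Om0t Om0t Omt Omt hAu
  have g2 := gap_aux S Om0t Om0t1 Omt Omt1 hBu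
  have hm := hmax Om0t Omt h0tsym h0tpd htsym htpd
  have hl := log_det_sub_le_aux hA hB
  have hq := quad_nonneg_aux S hSp
    (fun l => Omt1 l - (Om0t1 + ∑ k, Omt1 k) * (Om0t + ∑ k, Omt k)⁻¹ * Omt l) hB
  have hAs : (Om0t + ∑ k, Omt k)ᵀ = Om0t + ∑ k, Omt k := by
    simpa using hA.isHermitian.eq
  have hBs : (Om0t1 + ∑ k, Omt1 k)ᵀ = Om0t1 + ∑ k, Omt1 k := by
    simpa using hB.isHermitian.eq
  have htr : ∀ m, (Omt1 m - (Om0t1 + ∑ k, Omt1 k) * (Om0t + ∑ k, Omt k)⁻¹ * Omt m)ᵀ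
      = Omt1 m - Omt m * (Om0t + ∑ k, Omt k)⁻¹ * (Om0t1 + ∑ k, Omt1 k) := by
    intro m
    rw [Matrix.transpose_sub, Matrix.transpose_mul, Matrix.transpose_mul,
      Matrix.transpose_nonsing_inv, hAs, hBs, (ht1sym m).eq, (htsym m).eq, Matrix.mul_assoc]
  simp only [htr] at hq
  rw [Matrix.mul_nonsing_inv _ hAu] at g1
  simp only [Matrix.one_mul, sub_self, Matrix.zero_mul, Matrix.trace_zero,
    Finset.sum_const_zero, Matrix.trace_one, Fintype.card_fin] at g1
  linarith
end

section
/- Let Ω be a real symmetric positive definite p×p matrix whose smallest eigenvalue is at least τ_1 > 0, and let Δ be a real symmetric p×p matrix with ‖Ω⁻¹Δ‖ < 1 (operator norm). Then Ω + Δ is invertible and ‖(Ω + Δ)⁻¹ − Ω⁻¹‖_F ≤ ‖Δ‖_F / τ_1² + ‖Δ‖_F² / (τ_1³ (1 − ‖Ω⁻¹Δ‖)). -/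
/-- The ℓ2 operator (spectral) norm of a real square matrix. -/
noncomputable def opNorm {n : Type*} [Fintype n] [DecidableEq n]
    (M : Matrix n n ℝ) : ℝ :=
  ‖Matrix.toEuclideanCLM (𝕜 := ℝ) M‖

/-- The Frobenius norm of a real matrix. -/
noncomputable def frobNorm {m n : Type*} [Fintype m] [Fintype n]
    (M : Matrix m n ℝ) : ℝ :=
  Real.sqrt (∑ i, ∑ j, (M i j) ^ 2)

section FrobHelpers

attribute [local instance] Matrix.frobeniusNormedAddCommGroup in
theorem frobNorm_eq_norm_aux {n : Type*} [Fintype n] (M : Matrix n n ℝ) : frobNorm M = ‖M‖ := by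
  rw [Matrix.frobenius_norm_def, frobNorm, Real.sqrt_eq_rpow]
  simp

attribute [local instance] Matrix.frobeniusNormedAddCommGroup in
theorem frobNorm_add_le_aux {n : Type*} [Fintype n] (M N : Matrix n n ℝ) :
    frobNorm (M + N) ≤ frobNorm M + frobNorm N := by
  simp only [frobNorm_eq_norm_aux]
  exact norm_add_le M N

attribute [local instance] Matrix.frobeniusNormedAddCommGroup in
theorem frobNorm_neg_aux {n : Type*} [Fintype n] (M : Matrix n n ℝ) :
    frobNorm (-M) = frobNorm M := by
  simp only [frobNorm_eq_norm_aux]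
  exact norm_neg M

attribute [local instance] Matrix.frobeniusNormedAddCommGroup in
theorem frobNorm_mul_le_aux {n : Type*} [Fintype n] (M N : Matrix n n ℝ) :
    frobNorm (M * N) ≤ frobNorm M * frobNorm N := by
  simp only [frobNorm_eq_norm_aux]
  exact Matrix.frobenius_norm_mul M N

attribute [local instance] Matrix.frobeniusNormedAddCommGroup in
theorem frobNorm_transpose_aux {n : Type*} [Fintype n] (M : Matrix n n ℝ) :
    frobNorm M.transpose = frobNorm M := by
  simp only [frobNorm_eq_norm_aux]
  exact Matrix.frobenius_norm_transpose M

end FrobHelpers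

section OpHelpers

open scoped Matrix

theorem frobNorm_nonneg_aux {n : Type*} [Fintype n] (M : Matrix n n ℝ) : 0 ≤ frobNorm M :=
  Real.sqrt_nonneg _

theorem opNorm_nonneg_aux {n : Type*} [Fintype n] [DecidableEq n] (M : Matrix n n ℝ) :
    0 ≤ opNorm M := norm_nonneg _

theorem opNorm_mulVec_aux {n : Type*} [Fintype n] [DecidableEq n] (M : Matrix n n ℝ)
    (v : n → ℝ) : ‖WithLp.toLp 2 (M *ᵥ v)‖ ≤ opNorm M * ‖WithLp.toLp 2 v‖ := by
  have := (Matrix.toEuclideanCLM (𝕜 := ℝ) M).le_opNorm (WithLp.toLp 2 v)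
  rwa [Matrix.toEuclideanCLM_toLp] at this

theorem opNorm_le_aux {n : Type*} [Fintype n] [DecidableEq n] (M : Matrix n n ℝ) (c : ℝ)
    (hc : 0 ≤ c)
    (h : ∀ v : n → ℝ, ‖WithLp.toLp 2 (M *ᵥ v)‖ ≤ c * ‖WithLp.toLp 2 v‖) : opNorm M ≤ c := by
  refine ContinuousLinearMap.opNorm_le_bound _ hc fun x => ?_
  have := h (WithLp.ofLp x)
  rwa [← Matrix.toEuclideanCLM_toLp] at this

open scoped Matrix.Norms.L2Operator in
theorem opNorm_transpose_aux {n : Type*} [Fintype n] [DecidableEq n] (M : Matrix n n ℝ) :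
    opNorm Mᵀ = opNorm M := by
  have := Matrix.l2_opNorm_conjTranspose M
  rwa [Matrix.conjTranspose_eq_transpose_of_trivial] at this

theorem frobNorm_op_mul_aux {n : Type*} [Fintype n] [DecidableEq n] (M N : Matrix n n ℝ) :
    frobNorm (M * N) ≤ opNorm M * frobNorm N := by
  have key : ∀ P : Matrix n n ℝ,
      ∑ i, ∑ j, (P i j) ^ 2 = ∑ j, ‖WithLp.toLp 2 (fun i => P i j)‖ ^ 2 := by
    intro P
    rw [Finset.sum_comm]
    simp [EuclideanSpace.norm_sq_eq]
  unfold frobNorm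
  rw [Real.sqrt_le_iff]
  refine ⟨mul_nonneg (opNorm_nonneg_aux M) (Real.sqrt_nonneg _), ?_⟩
  rw [mul_pow, Real.sq_sqrt (by positivity), key, key, Finset.mul_sum]
  refine Finset.sum_le_sum fun j _ => ?_
  rw [← mul_pow]
  refine pow_le_pow_left₀ (norm_nonneg _) ?_ 2
  exact opNorm_mulVec_aux M (fun i => N i j)

theorem frobNorm_mul_op_aux {n : Type*} [Fintype n] [DecidableEq n] (M N : Matrix n n ℝ) :
    frobNorm (M * N) ≤ frobNorm M * opNorm N := by
  rw [← frobNorm_transpose_aux, Matrix.transpose_mul, ← frobNorm_transpose_aux M,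
    ← opNorm_transpose_aux N, mul_comm]
  exact frobNorm_op_mul_aux _ _

open scoped MatrixOrder in
theorem coercive_aux {n : Type*} [Fintype n] [DecidableEq n] (Om : Matrix n n ℝ)
    (h : Om.IsHermitian) (t : ℝ) (heig : ∀ i, t ≤ h.eigenvalues i) (v : n → ℝ) :
    t * ‖WithLp.toLp 2 v‖ ^ 2 ≤ v ⬝ᵥ (Om *ᵥ v) := by
  have h1 : algebraMap ℝ (Matrix n n ℝ) t ≤ Om := by
    rw [algebraMap_le_iff_le_spectrum (a := Om) (ha := h)]
    intro x hx
    rw [h.spectrum_real_eq_range_eigenvalues] at hx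
    obtain ⟨i, rfl⟩ := hx
    exact heig i
  rw [Matrix.le_iff] at h1
  have h2 := h1.dotProduct_mulVec_nonneg v
  rw [Matrix.sub_mulVec, dotProduct_sub, Algebra.algebraMap_eq_smul_one, Matrix.smul_mulVec,
    Matrix.one_mulVec, dotProduct_smul] at h2
  rw [EuclideanSpace.norm_sq_eq]
  simp only [star_trivial, smul_eq_mul, dotProduct] at h2 ⊢
  simp only [Real.norm_eq_abs, sq_abs]
  simp only [pow_two]
  linarith

end OpHelpers

/-- if `Ω` is real symmetric positive definite with smallest eigenvalue at
least `τ_1 > 0` and `Δ` is symmetric with `‖Ω⁻¹Δ‖ < 1` (operator norm), then `Ω + Δ` is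
invertible and
`‖(Ω + Δ)⁻¹ − Ω⁻¹‖_F ≤ ‖Δ‖_F / τ_1² + ‖Δ‖_F² / (τ_1³ (1 − ‖Ω⁻¹Δ‖))`. -/
theorem perturbed_inverse_frobenius_bound
    (p : ℕ) (τ1 : ℝ) (hτ1 : 0 < τ1)
    (Om Δ : Matrix (Fin p) (Fin p) ℝ)
    (hOmsym : Om.IsSymm) (hOmpd : Om.PosDef)
    (heig : ∀ i, τ1 ≤ hOmpd.1.eigenvalues i)
    (hΔsym : Δ.IsSymm) (hsmall : opNorm (Om⁻¹ * Δ) < 1) :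
    IsUnit (Om + Δ).det ∧
      frobNorm ((Om + Δ)⁻¹ - Om⁻¹)
        ≤ frobNorm Δ / τ1 ^ 2
          + frobNorm Δ ^ 2 / (τ1 ^ 3 * (1 - opNorm (Om⁻¹ * Δ))) := by
  have hdet : IsUnit Om.det := hOmpd.det_pos.ne'.isUnit
  have hA1 : Om⁻¹ * Om = 1 := Matrix.nonsing_inv_mul _ hdet
  have hA2 : Om * Om⁻¹ = 1 := Matrix.mul_nonsing_inv _ hdet
  set A := Om⁻¹ with hA
  set e := opNorm (A * Δ) with he
  -- operator norm of the inverse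
  have hAop : opNorm A ≤ 1 / τ1 := by
    refine opNorm_le_aux _ _ (by positivity) fun v => ?_
    have h1 := coercive_aux Om hOmpd.1 τ1 heig (Matrix.mulVec A v)
    rw [Matrix.mulVec_mulVec, hA2, Matrix.one_mulVec] at h1
    have h2 : dotProduct (Matrix.mulVec A v) v
        ≤ ‖WithLp.toLp 2 (Matrix.mulVec A v)‖ * ‖WithLp.toLp 2 v‖ := by
      have := real_inner_le_norm (WithLp.toLp 2 (Matrix.mulVec A v)) (WithLp.toLp 2 v)
      rw [EuclideanSpace.inner_eq_star_dotProduct] at this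
      simpa [dotProduct_comm] using this
    rw [div_mul_eq_mul_div, one_mul, le_div_iff₀ hτ1]
    by_contra hcon
    push Not at hcon
    have h3 := norm_nonneg (WithLp.toLp 2 (Matrix.mulVec A v))
    have h4 := norm_nonneg (WithLp.toLp 2 v)
    rcases h3.eq_or_lt with h0 | h0
    · rw [← h0] at hcon
      linarith
    · nlinarith
  have hlow : ∀ x : Fin p → ℝ, (1 - e) * ‖WithLp.toLp 2 x‖
      ≤ ‖WithLp.toLp 2 (Matrix.mulVec (A * (Om + Δ)) x)‖ := by
    intro x
    have h1 := opNorm_mulVec_aux (A * Δ) x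
    have h2 : WithLp.toLp 2 x = WithLp.toLp 2 (Matrix.mulVec (A * (Om + Δ)) x)
        - WithLp.toLp 2 (Matrix.mulVec (A * Δ) x) := by
      rw [Matrix.mul_add, hA1, Matrix.add_mulVec, Matrix.one_mulVec, WithLp.toLp_add]
      abel
    have h3 := norm_sub_le (WithLp.toLp 2 (Matrix.mulVec (A * (Om + Δ)) x))
      (WithLp.toLp 2 (Matrix.mulVec (A * Δ) x))
    rw [← h2] at h3
    linarith
  have he1 : 0 < 1 - e := by linarith
  have hunit : IsUnit (Om + Δ).det := by
    rw [isUnit_iff_ne_zero]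
    intro h0
    obtain ⟨v, hv, hv0⟩ := Matrix.exists_mulVec_eq_zero_iff.mpr h0
    have h1 := hlow v
    rw [← Matrix.mulVec_mulVec, hv0, Matrix.mulVec_zero, WithLp.toLp_zero, norm_zero] at h1
    have h2 : 0 < ‖WithLp.toLp 2 v‖ := by
      rw [norm_pos_iff]
      intro h
      exact hv (by simpa using h)
    nlinarith
  refine ⟨hunit, ?_⟩
  have hX1 : (Om + Δ)⁻¹ * (Om + Δ) = 1 := Matrix.nonsing_inv_mul _ hunit
  have hX2 : (Om + Δ) * (Om + Δ)⁻¹ = 1 := Matrix.mul_nonsing_inv _ hunit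
  set X := (Om + Δ)⁻¹ with hX
  have hXop : opNorm X ≤ 1 / (τ1 * (1 - e)) := by
    refine opNorm_le_aux _ _ (by positivity) fun v => ?_
    have h1 := hlow (Matrix.mulVec X v)
    rw [Matrix.mulVec_mulVec, Matrix.mul_assoc, hX2, Matrix.mul_one] at h1
    have h2 := opNorm_mulVec_aux A v
    have h3 := mul_le_mul_of_nonneg_right hAop (norm_nonneg (WithLp.toLp 2 v))
    have h4 : (1 - e) * ‖WithLp.toLp 2 (Matrix.mulVec X v)‖ ≤ 1 / τ1 * ‖WithLp.toLp 2 v‖ := by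
      linarith
    rw [← le_div_iff₀' he1] at h4
    refine h4.trans_eq ?_
    field_simp
  have hid : X - A = -(A * Δ * A) + A * (Δ * X * Δ) * A := by
    have e1 : X - A = -(A * Δ * X) := by
      have : A * ((Om + Δ) * X) = A := by rw [hX2, Matrix.mul_one]
      rw [Matrix.add_mul, Matrix.mul_add, ← Matrix.mul_assoc, hA1, Matrix.one_mul,
        ← Matrix.mul_assoc] at this
      rw [sub_eq_iff_eq_add, eq_neg_add_iff_add_eq, add_comm]
      exact this
    have e2 : X - A = -(X * Δ * A) := by
      have : (X * (Om + Δ)) * A = A := by rw [hX1, Matrix.one_mul]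
      rw [Matrix.mul_add, Matrix.add_mul, Matrix.mul_assoc, hA2, Matrix.mul_one] at this
      rw [sub_eq_iff_eq_add, eq_neg_add_iff_add_eq, add_comm]
      exact this
    have e3 : X = A - X * Δ * A := by rw [sub_eq_add_neg, ← e2]; abel
    rw [e1]
    nth_rewrite 1 [e3]
    noncomm_ring
  have hsand : ∀ M : Matrix (Fin p) (Fin p) ℝ, frobNorm (A * M * A) ≤ frobNorm M / τ1 ^ 2 := by
    intro M
    have hm := frobNorm_nonneg_aux M
    have ha := opNorm_nonneg_aux A
    calc frobNorm (A * M * A) ≤ frobNorm (A * M) * opNorm A := frobNorm_mul_op_aux _ _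
      _ ≤ (opNorm A * frobNorm M) * opNorm A := by
        gcongr
        exact frobNorm_op_mul_aux _ _
      _ ≤ (1 / τ1 * frobNorm M) * (1 / τ1) := by gcongr
      _ = frobNorm M / τ1 ^ 2 := by field_simp
  have hd := frobNorm_nonneg_aux Δ
  have hmid : frobNorm (Δ * X * Δ) ≤ frobNorm Δ ^ 2 / (τ1 * (1 - e)) := by
    calc frobNorm (Δ * X * Δ) ≤ frobNorm (Δ * X) * frobNorm Δ := frobNorm_mul_le_aux _ _
      _ ≤ (frobNorm Δ * opNorm X) * frobNorm Δ := by
        gcongr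
        exact frobNorm_mul_op_aux _ _
      _ ≤ (frobNorm Δ * (1 / (τ1 * (1 - e)))) * frobNorm Δ := by gcongr
      _ = frobNorm Δ ^ 2 / (τ1 * (1 - e)) := by ring
  rw [hid]
  refine (frobNorm_add_le_aux _ _).trans ?_
  rw [frobNorm_neg_aux]
  refine add_le_add (hsand Δ) ((hsand _).trans ?_)
  calc frobNorm (Δ * X * Δ) / τ1 ^ 2 ≤ frobNorm Δ ^ 2 / (τ1 * (1 - e)) / τ1 ^ 2 := by gcongr
    _ = frobNorm Δ ^ 2 / (τ1 ^ 3 * (1 - e)) := by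
      rw [div_div]
      congr 1
      ring
end

section
/- Suppose that for each k = 0, 1, …, K the matrix Ω_k decomposes as Ω_k = B_k + D_k, where B_k is a real symmetric p×p matrix whose eigenvalues all lie in [τ_3, τ_4] with 0 < τ_3 ≤ τ_4, and D_k is a diagonal p×p matrix with all diagonal entries at least ε > 0. Set A = Σ_{k=0}^{K} Ω_k. Then A is invertible and for every 0 ≤ l ≤ K, both ‖Ω_l A⁻¹‖ and ‖A⁻¹ Ω_l‖ are at most ((K + 2) ε τ_4 + (K + 1) ε² + τ_4²) / ((K + 1) ε²), where ‖·‖ denotes the operator norm. -/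
open Matrix in
lemma aux_opNorm_le {n : Type*} [Fintype n] [DecidableEq n] (B : Matrix n n ℝ) (hB : B.IsHermitian)
    (t : ℝ) (ht : 0 ≤ t) (h : ∀ i, |hB.eigenvalues i| ≤ t) : opNorm B ≤ t := by
  open scoped Matrix.Norms.L2Operator in
  have h1 : opNorm B = ‖B‖ := rfl
  rw [h1]
  have h2 := hB.spectral_theorem
  rw [h2, Unitary.conjStarAlgAut_apply, ← Unitary.coe_star, CStarRing.norm_mul_coe_unitary,
    CStarRing.norm_coe_unitary_mul, Matrix.l2_opNorm_diagonal]
  rw [pi_norm_le_iff_of_nonneg ht]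
  intro i
  simpa using h i

open Matrix in
lemma aux_star {n : Type*} [Fintype n] [DecidableEq n] (M : Matrix n n ℝ) :
    opNorm Mᴴ = opNorm M := by
  open scoped Matrix.Norms.L2Operator in
  have h1 : ∀ M : Matrix n n ℝ, opNorm M = ‖M‖ := fun _ => rfl
  rw [h1, h1, Matrix.l2_opNorm_conjTranspose]

open Matrix in
lemma aux_vec {n : Type*} [Fintype n] [DecidableEq n] (M : Matrix n n ℝ) (y : EuclideanSpace ℝ n) :
    ‖toEuclideanCLM (𝕜 := ℝ) M y‖ ≤ opNorm M * ‖y‖ :=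
  ContinuousLinearMap.le_opNorm _ _

open Matrix in
lemma aux_coercive {n : Type*} [Fintype n] [DecidableEq n] (A : Matrix n n ℝ) (c : ℝ)
    (h : (A - c • (1 : Matrix n n ℝ)).PosSemidef) (y : EuclideanSpace ℝ n) :
    c * ‖y‖ ≤ ‖toEuclideanCLM (𝕜 := ℝ) A y‖ := by
  have h1 := h.dotProduct_mulVec_nonneg y.ofLp
  have h2 : inner ℝ y (toEuclideanCLM (𝕜 := ℝ) A y) = y.ofLp ⬝ᵥ (A *ᵥ y.ofLp) := by
    rw [EuclideanSpace.inner_eq_star_dotProduct, ofLp_toEuclideanCLM, dotProduct_comm]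
    simp
  have h3 : ‖y‖ ^ 2 = y.ofLp ⬝ᵥ y.ofLp := by
    rw [← real_inner_self_eq_norm_sq, EuclideanSpace.inner_eq_star_dotProduct]
    simp
  have h4 := real_inner_le_norm y (toEuclideanCLM (𝕜 := ℝ) A y)
  simp only [star_trivial, sub_mulVec, smul_mulVec, one_mulVec, dotProduct_sub, dotProduct_smul,
    smul_eq_mul] at h1
  rw [← h3, ← h2] at h1
  rcases eq_or_ne y 0 with rfl | hy
  · simp
  · have : 0 < ‖y‖ := norm_pos_iff.mpr hy
    nlinarith

open Matrix in
lemma aux_diag {n : Type*} [Fintype n] [DecidableEq n] (a b : n → ℝ)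
    (h : ∀ i, |a i| ≤ |b i|) (y : EuclideanSpace ℝ n) :
    ‖toEuclideanCLM (𝕜 := ℝ) (diagonal a) y‖ ≤ ‖toEuclideanCLM (𝕜 := ℝ) (diagonal b) y‖ := by
  rw [EuclideanSpace.norm_eq, EuclideanSpace.norm_eq]
  apply Real.sqrt_le_sqrt
  apply Finset.sum_le_sum
  intro i _
  simp only [ofLp_toEuclideanCLM, mulVec_diagonal, norm_mul, Real.norm_eq_abs]
  refine pow_le_pow_left₀ (by positivity) (mul_le_mul_of_nonneg_right ?_ (abs_nonneg _)) 2
  exact h i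

/-- if each `Ω_k = B_k + D_k` (`k = 0, …, K`) with `B_k` real symmetric with
eigenvalues in `[τ_3, τ_4]` (`0 < τ_3 ≤ τ_4`) and `D_k` diagonal with diagonal entries at
least `ε > 0`, then `A = Σ_k Ω_k` is invertible and for every `l`, both `‖Ω_l A⁻¹‖` and
`‖A⁻¹ Ω_l‖` are at most `((K+2) ε τ_4 + (K+1) ε² + τ_4²) / ((K+1) ε²)`. -/
theorem product_with_inverse_sum_operator_norm_bound
    (p K : ℕ) (τ3 τ4 ε : ℝ) (hτ3 : 0 < τ3) (hτ34 : τ3 ≤ τ4) (hε : 0 < ε)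
    (B D : Fin (K + 1) → Matrix (Fin p) (Fin p) ℝ)
    (hB : ∀ k, (B k).IsHermitian)
    (hBeig : ∀ k (i : Fin p), (hB k).eigenvalues i ∈ Set.Icc τ3 τ4)
    (hDdiag : ∀ k, ∀ i j : Fin p, i ≠ j → D k i j = 0)
    (hDpos : ∀ k (i : Fin p), ε ≤ D k i i) :
    IsUnit (∑ k, (B k + D k)).det ∧
      ∀ l : Fin (K + 1),
        opNorm ((B l + D l) * (∑ k, (B k + D k))⁻¹)
            ≤ (((K : ℝ) + 2) * ε * τ4 + ((K : ℝ) + 1) * ε ^ 2 + τ4 ^ 2)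
              / (((K : ℝ) + 1) * ε ^ 2) ∧
        opNorm ((∑ k, (B k + D k))⁻¹ * (B l + D l))
            ≤ (((K : ℝ) + 2) * ε * τ4 + ((K : ℝ) + 1) * ε ^ 2 + τ4 ^ 2)
              / (((K : ℝ) + 1) * ε ^ 2) := by
  classical
  have hτ4 : 0 < τ4 := hτ3.trans_le hτ34
  have hn : (0 : ℝ) < (K : ℝ) + 1 := by positivity
  set A := ∑ k, (B k + D k) with hA
  have hD : ∀ k, D k = Matrix.diagonal (fun i => D k i i) := by
    intro k
    ext i j
    by_cases hij : i = j
    · subst hij; simp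
    · rw [hDdiag k i j hij, Matrix.diagonal_apply_ne _ hij]
  have hBpsd : ∀ k, (B k).PosSemidef := fun k =>
    (hB k).posSemidef_iff_eigenvalues_nonneg.mpr fun i => (hτ3.trans_le (hBeig k i).1).le
  have hDpsd : ∀ k, (D k - ε • (1 : Matrix (Fin p) (Fin p) ℝ)).PosSemidef := by
    intro k
    rw [hD k, ← Matrix.diagonal_one, ← Matrix.diagonal_smul, Matrix.diagonal_sub]
    apply Matrix.PosSemidef.diagonal
    intro i
    simpa using hDpos k i
  have hApsd : (A - (((K : ℝ) + 1) * ε) • (1 : Matrix (Fin p) (Fin p) ℝ)).PosSemidef := by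
    have : A - (((K : ℝ) + 1) * ε) • (1 : Matrix (Fin p) (Fin p) ℝ)
        = ∑ k, (B k + (D k - ε • (1 : Matrix (Fin p) (Fin p) ℝ))) := by
      simp only [← add_sub_assoc, Finset.sum_sub_distrib, Finset.sum_const, Finset.card_univ,
        Fintype.card_fin, hA, mul_smul]
      rw [← Nat.cast_smul_eq_nsmul ℝ]
      push_cast
      rfl
    rw [this]
    exact Matrix.posSemidef_sum _ fun k _ => (hBpsd k).add (hDpsd k)
  have hApd : A.PosDef := by
    have h1 : ((((K : ℝ) + 1) * ε) • (1 : Matrix (Fin p) (Fin p) ℝ)).PosDef :=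
      Matrix.PosDef.one.smul (by positivity)
    simpa using Matrix.PosDef.posSemidef_add hApsd h1
  have hdet : IsUnit A.det := hApd.det_pos.ne'.isUnit
  refine ⟨hdet, fun l => ?_⟩
  set C := (((K : ℝ) + 2) * ε * τ4 + ((K : ℝ) + 1) * ε ^ 2 + τ4 ^ 2) / (((K : ℝ) + 1) * ε ^ 2)
    with hC
  have hC0 : 0 ≤ C := by positivity
  have hBn : ∀ k, opNorm (B k) ≤ τ4 := fun k =>
    aux_opNorm_le _ (hB k) _ hτ4.le fun i => by
      rw [abs_of_nonneg (hτ3.trans_le (hBeig k i).1).le]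
      exact (hBeig k i).2
  have hBv : ∀ k (y : EuclideanSpace ℝ (Fin p)),
      ‖Matrix.toEuclideanCLM (𝕜 := ℝ) (B k) y‖ ≤ τ4 * ‖y‖ := fun k y =>
    (aux_vec _ y).trans (mul_le_mul_of_nonneg_right (hBn k) (norm_nonneg _))
  have hT : ∑ k, D k = Matrix.diagonal (fun i => ∑ k, D k i i) := by
    ext i j
    rw [Matrix.sum_apply]
    by_cases hij : i = j
    · subst hij; simp
    · rw [Matrix.diagonal_apply_ne _ hij]
      exact Finset.sum_eq_zero fun k _ => hDdiag k i j hij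
  have key : ∀ y : EuclideanSpace ℝ (Fin p),
      ‖Matrix.toEuclideanCLM (𝕜 := ℝ) (B l + D l) y‖
        ≤ C * ‖Matrix.toEuclideanCLM (𝕜 := ℝ) A y‖ := by
    intro y
    have hy := aux_coercive A _ hApsd y
    have h1 : ‖Matrix.toEuclideanCLM (𝕜 := ℝ) (D l) y‖
        ≤ ‖Matrix.toEuclideanCLM (𝕜 := ℝ) (∑ k, D k) y‖ := by
      rw [hT, hD l]
      apply aux_diag
      intro i
      have h0 : ∀ k, 0 ≤ D k i i := fun k => hε.le.trans (hDpos k i)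
      rw [abs_of_nonneg (h0 l), abs_of_nonneg (Finset.sum_nonneg fun k _ => h0 k)]
      exact Finset.single_le_sum (f := fun k => D k i i) (fun k _ => h0 k) (Finset.mem_univ l)
    have h2 : Matrix.toEuclideanCLM (𝕜 := ℝ) (∑ k, D k) y
        = Matrix.toEuclideanCLM (𝕜 := ℝ) A y
          - ∑ k, Matrix.toEuclideanCLM (𝕜 := ℝ) (B k) y := by
      rw [hA, Finset.sum_add_distrib, map_add, map_sum _ B, ContinuousLinearMap.add_apply,
        ContinuousLinearMap.sum_apply]
      abel
    have h3 : ‖∑ k, Matrix.toEuclideanCLM (𝕜 := ℝ) (B k) y‖ ≤ ((K : ℝ) + 1) * (τ4 * ‖y‖) := by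
      refine (norm_sum_le_of_le _ fun k _ => hBv k y).trans ?_
      simp
    have h4 := norm_sub_le (Matrix.toEuclideanCLM (𝕜 := ℝ) A y)
      (∑ k, Matrix.toEuclideanCLM (𝕜 := ℝ) (B k) y)
    rw [← h2] at h4
    have h5 : ‖Matrix.toEuclideanCLM (𝕜 := ℝ) (B l + D l) y‖
        ≤ ‖Matrix.toEuclideanCLM (𝕜 := ℝ) (B l) y‖
          + ‖Matrix.toEuclideanCLM (𝕜 := ℝ) (D l) y‖ := by
      rw [map_add, ContinuousLinearMap.add_apply]
      exact norm_add_le _ _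
    have h6 := hBv l y
    set a := ‖Matrix.toEuclideanCLM (𝕜 := ℝ) A y‖
    have ha : 0 ≤ a := norm_nonneg _
    have h7 : ‖y‖ ≤ a / (((K : ℝ) + 1) * ε) := by
      rw [le_div_iff₀ (by positivity)]; linarith
    have h8 : (τ4 + ((K : ℝ) + 1) * τ4) * ‖y‖
        ≤ (τ4 + ((K : ℝ) + 1) * τ4) * (a / (((K : ℝ) + 1) * ε)) := by gcongr
    have h9 : C * a = (τ4 + ((K : ℝ) + 1) * τ4) * (a / (((K : ℝ) + 1) * ε)) + a
        + τ4 ^ 2 * a / (((K : ℝ) + 1) * ε ^ 2) := by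
      rw [hC]; field_simp; ring
    have h10 : 0 ≤ τ4 ^ 2 * a / (((K : ℝ) + 1) * ε ^ 2) := by positivity
    linarith
  have first : opNorm ((B l + D l) * A⁻¹) ≤ C := by
    refine ContinuousLinearMap.opNorm_le_bound _ hC0 fun x => ?_
    have h := key (Matrix.toEuclideanCLM (𝕜 := ℝ) A⁻¹ x)
    rw [← ContinuousLinearMap.mul_apply, ← ContinuousLinearMap.mul_apply, ← map_mul, ← map_mul,
      Matrix.mul_nonsing_inv _ hdet, map_one] at h
    exact h
  refine ⟨first, ?_⟩
  rw [← aux_star, Matrix.conjTranspose_mul, Matrix.conjTranspose_nonsing_inv, hApd.1.eq]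
  have : (B l + D l).conjTranspose = B l + D l := by
    rw [Matrix.conjTranspose_add, (hB l).eq, hD l, Matrix.diagonal_conjTranspose]
    simp
  rw [this]
  exact first
end
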